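/- arXiv:2601.08990 — 3 statements merged into one kernel-verified Lean document; each statement's English description precedes it below -/
import Mathlib

section
/- Pointwise nonnegativity of the spin–orbit BEC energy density (pointwise core of Lemma 2.1): Assume V_j ≥ (|δ| + |Ω| + 2k₀²)/2 for j = 1,2 (assumption (A2)) and β₁₁, β₂₂, β₁₂ ≥ 0 (assumption (A3)). Then for all u₁, u₂ ∈ ℂ and all g₁, g₂ ∈ ℂ^d with first components p₁ = g₁(0), p₂ = g₂(0), the energy density satisfies D ≥ (1/4)(‖g₁‖² + ‖g₂‖²) + Σ_{j=1,2} (V_j − (|δ| + |Ω| + 2k₀²)/2)|u_j|² + (β₁₁/2)|u₁|⁴ + (β₂₂/2)|u₂|⁴ + β₁₂|u₁|²|u₂|², and in particular D ≥ 0. -/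
open Complex

/-- Pointwise energy density of the spin–orbit coupled BEC at states `u₁ u₂ : ℂ`
with gradient vectors `g₁ g₂ : ℂ^d` whose first components are `p₁ p₂`. -/
noncomputable def energyDensity (d : ℕ) (δ Ω k₀ β₁₁ β₂₂ β₁₂ V₁ V₂ : ℝ)
    (u₁ u₂ : ℂ) (g₁ g₂ : EuclideanSpace ℂ (Fin d)) (p₁ p₂ : ℂ) : ℝ :=
  (1 / 2) * (‖g₁‖ ^ 2 + ‖g₂‖ ^ 2) + V₁ * ‖u₁‖ ^ 2 + V₂ * ‖u₂‖ ^ 2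
    + (δ / 2) * (‖u₁‖ ^ 2 - ‖u₂‖ ^ 2) + Ω * (u₁ * (starRingEnd ℂ) u₂).re
    + (Complex.I * (k₀ : ℂ) * ((starRingEnd ℂ) u₁ * p₁ - (starRingEnd ℂ) u₂ * p₂)).re
    + (β₁₁ / 2) * ‖u₁‖ ^ 4 + (β₂₂ / 2) * ‖u₂‖ ^ 4 + β₁₂ * ‖u₁‖ ^ 2 * ‖u₂‖ ^ 2

lemma neg_le_re_I_mul_conj_mul (k : ℝ) (u p : ℂ) :
    -(‖p‖ ^ 2 / 4 + k ^ 2 * ‖u‖ ^ 2) ≤ (Complex.I * (k : ℂ) * ((starRingEnd ℂ) u * p)).re := by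
  have h := Complex.abs_re_le_norm (Complex.I * (k : ℂ) * ((starRingEnd ℂ) u * p))
  simp only [norm_mul, Complex.norm_I, one_mul, Complex.norm_real, Real.norm_eq_abs,
    RCLike.norm_conj] at h
  have h' := (abs_le.mp h).1
  nlinarith [sq_nonneg (‖p‖ / 2 - |k| * ‖u‖), sq_abs k]

lemma neg_le_mul_re_mul_conj (c : ℝ) (u v : ℂ) :
    -(|c| / 2 * (‖u‖ ^ 2 + ‖v‖ ^ 2)) ≤ c * (u * (starRingEnd ℂ) v).re := by
  have h : |c * (u * (starRingEnd ℂ) v).re| ≤ |c| * (‖u‖ * ‖v‖) := by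
    rw [abs_mul]
    gcongr
    simpa using Complex.abs_re_le_norm (u * (starRingEnd ℂ) v)
  have h' := (abs_le.mp h).1
  nlinarith [mul_nonneg (abs_nonneg c) (sq_nonneg (‖u‖ - ‖v‖))]

/-- Pointwise nonnegativity of the spin–orbit BEC energy density
(pointwise core of Lemma 2.1). -/
theorem energyDensity_nonneg (d : ℕ) (hd : 1 ≤ d)
    (δ Ω k₀ β₁₁ β₂₂ β₁₂ V₁ V₂ : ℝ)
    (hV₁ : V₁ ≥ (|δ| + |Ω| + 2 * k₀ ^ 2) / 2)
    (hV₂ : V₂ ≥ (|δ| + |Ω| + 2 * k₀ ^ 2) / 2)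
    (hβ₁₁ : 0 ≤ β₁₁) (hβ₂₂ : 0 ≤ β₂₂) (hβ₁₂ : 0 ≤ β₁₂)
    (u₁ u₂ : ℂ) (g₁ g₂ : EuclideanSpace ℂ (Fin d)) :
    energyDensity d δ Ω k₀ β₁₁ β₂₂ β₁₂ V₁ V₂ u₁ u₂ g₁ g₂ (g₁ ⟨0, hd⟩) (g₂ ⟨0, hd⟩)
        ≥ (1 / 4) * (‖g₁‖ ^ 2 + ‖g₂‖ ^ 2)
          + (V₁ - (|δ| + |Ω| + 2 * k₀ ^ 2) / 2) * ‖u₁‖ ^ 2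
          + (V₂ - (|δ| + |Ω| + 2 * k₀ ^ 2) / 2) * ‖u₂‖ ^ 2
          + (β₁₁ / 2) * ‖u₁‖ ^ 4 + (β₂₂ / 2) * ‖u₂‖ ^ 4
          + β₁₂ * ‖u₁‖ ^ 2 * ‖u₂‖ ^ 2
      ∧ energyDensity d δ Ω k₀ β₁₁ β₂₂ β₁₂ V₁ V₂ u₁ u₂ g₁ g₂ (g₁ ⟨0, hd⟩) (g₂ ⟨0, hd⟩)
          ≥ 0 := by
  rw [and_iff_left_of_imp fun h => le_trans ?_ h]
  · have hp₁ := pow_le_pow_left₀ (norm_nonneg _) (PiLp.norm_apply_le g₁ ⟨0, hd⟩) 2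
    have hp₂ := pow_le_pow_left₀ (norm_nonneg _) (PiLp.norm_apply_le g₂ ⟨0, hd⟩) 2
    have h₁ := neg_le_re_I_mul_conj_mul k₀ u₁ (g₁ ⟨0, hd⟩)
    have h₂ := neg_le_re_I_mul_conj_mul (-k₀) u₂ (g₂ ⟨0, hd⟩)
    have hΩ := neg_le_mul_re_mul_conj Ω u₁ u₂
    have hδ₁ := mul_le_mul_of_nonneg_right (neg_abs_le δ) (sq_nonneg ‖u₁‖)
    have hδ₂ := mul_le_mul_of_nonneg_right (le_abs_self δ) (sq_nonneg ‖u₂‖)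
    have hsplit : (Complex.I * (k₀ : ℂ) * ((starRingEnd ℂ) u₁ * g₁ ⟨0, hd⟩
        - (starRingEnd ℂ) u₂ * g₂ ⟨0, hd⟩)).re
        = (Complex.I * (k₀ : ℂ) * ((starRingEnd ℂ) u₁ * g₁ ⟨0, hd⟩)).re
          + (Complex.I * ((-k₀ : ℝ) : ℂ) * ((starRingEnd ℂ) u₂ * g₂ ⟨0, hd⟩)).re := by
      rw [← Complex.add_re]
      congr 1
      push_cast
      ring
    unfold energyDensity
    rw [hsplit]
    linarith
  · have := sub_nonneg.mpr hV₁
    have := sub_nonneg.mpr hV₂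
    positivity
end

section
/- Pointwise coercivity of the linearized A-form density (pointwise core of Lemma 3.1): Assume V_j ≥ (|δ| + |Ω| + 2k₀²)/2 for j = 1,2 (assumption (A2)). Then for all v₁, v₂ ∈ ℂ, all h₁, h₂ ∈ ℂ^d with first components q₁ = h₁(0), q₂ = h₂(0), and all real weights c₁, c₂ ≥ 0, one has Q := (1/2)(‖h₁‖² + ‖h₂‖²) + V₁|v₁|² + V₂|v₂|² + (δ/2)(|v₁|² − |v₂|²) + Ω·Re(v₁·conj(v₂)) + Re(i·k₀·(conj(v₁)·q₁ − conj(v₂)·q₂)) + c₁|v₁|² + c₂|v₂|² ≥ (1/4)(‖h₁‖² + ‖h₂‖²). -/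
open Complex

/-- Young's inequality for the Raman coupling term. -/
lemma abs_re_I_mul_conj_mul_le (k : ℝ) (v q : ℂ) :
    |(Complex.I * (k : ℂ) * ((starRingEnd ℂ) v * q)).re| ≤ k ^ 2 * ‖v‖ ^ 2 + (1 / 4) * ‖q‖ ^ 2 := by
  have h := Complex.abs_re_le_norm (Complex.I * (k : ℂ) * ((starRingEnd ℂ) v * q))
  simp only [norm_mul, Complex.norm_I, Complex.norm_real, Real.norm_eq_abs, RCLike.norm_conj,
    one_mul] at h
  nlinarith [sq_nonneg (|k| * ‖v‖ - ‖q‖ / 2), sq_abs k]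

/-- Young's inequality for the Rabi coupling term. -/
lemma abs_mul_re_mul_conj_le (Ω : ℝ) (v w : ℂ) :
    |Ω * (v * (starRingEnd ℂ) w).re| ≤ |Ω| / 2 * (‖v‖ ^ 2 + ‖w‖ ^ 2) := by
  have h := Complex.abs_re_le_norm (v * (starRingEnd ℂ) w)
  rw [norm_mul, RCLike.norm_conj] at h
  rw [abs_mul]
  nlinarith [mul_le_mul_of_nonneg_left h (abs_nonneg Ω),
    mul_nonneg (abs_nonneg Ω) (sq_nonneg (‖v‖ - ‖w‖))]

/-- Pointwise coercivity of the linearized `A`-form density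
(pointwise core of Lemma 3.1). -/
theorem aForm_density_coercive (d : ℕ) (hd : 1 ≤ d)
    (δ Ω k₀ V₁ V₂ : ℝ)
    (hV₁ : V₁ ≥ (|δ| + |Ω| + 2 * k₀ ^ 2) / 2)
    (hV₂ : V₂ ≥ (|δ| + |Ω| + 2 * k₀ ^ 2) / 2)
    (c₁ c₂ : ℝ) (hc₁ : 0 ≤ c₁) (hc₂ : 0 ≤ c₂)
    (v₁ v₂ : ℂ) (h₁ h₂ : EuclideanSpace ℂ (Fin d)) :
    (1 / 2) * (‖h₁‖ ^ 2 + ‖h₂‖ ^ 2) + V₁ * ‖v₁‖ ^ 2 + V₂ * ‖v₂‖ ^ 2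
        + (δ / 2) * (‖v₁‖ ^ 2 - ‖v₂‖ ^ 2) + Ω * (v₁ * (starRingEnd ℂ) v₂).re
        + (Complex.I * (k₀ : ℂ) *
            ((starRingEnd ℂ) v₁ * h₁ ⟨0, hd⟩ - (starRingEnd ℂ) v₂ * h₂ ⟨0, hd⟩)).re
        + c₁ * ‖v₁‖ ^ 2 + c₂ * ‖v₂‖ ^ 2
      ≥ (1 / 4) * (‖h₁‖ ^ 2 + ‖h₂‖ ^ 2) := by
  have hq₁ : ‖h₁ ⟨0, hd⟩‖ ^ 2 ≤ ‖h₁‖ ^ 2 := by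
    gcongr
    exact PiLp.norm_apply_le h₁ _
  have hq₂ : ‖h₂ ⟨0, hd⟩‖ ^ 2 ≤ ‖h₂‖ ^ 2 := by
    gcongr
    exact PiLp.norm_apply_le h₂ _
  have hk₁ := (abs_le.mp (abs_re_I_mul_conj_mul_le k₀ v₁ (h₁ ⟨0, hd⟩))).1
  have hk₂ := (abs_le.mp (abs_re_I_mul_conj_mul_le k₀ v₂ (h₂ ⟨0, hd⟩))).2
  have hΩ := (abs_le.mp (abs_mul_re_mul_conj_le Ω v₁ v₂)).1
  have hδ₁ := mul_le_mul_of_nonneg_right (neg_abs_le δ) (sq_nonneg ‖v₁‖)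
  have hδ₂ := mul_le_mul_of_nonneg_right (le_abs_self δ) (sq_nonneg ‖v₂‖)
  have hv₁ := mul_le_mul_of_nonneg_right hV₁ (sq_nonneg ‖v₁‖)
  have hv₂ := mul_le_mul_of_nonneg_right hV₂ (sq_nonneg ‖v₂‖)
  have hw₁ := mul_nonneg hc₁ (sq_nonneg ‖v₁‖)
  have hw₂ := mul_nonneg hc₂ (sq_nonneg ‖v₂‖)
  rw [mul_sub (Complex.I * (k₀ : ℂ)), Complex.sub_re]
  linarith
end

section
/- Absence of Jordan chains at the ground-state eigenvalue (second part of Lemma 5.1, abstract form): Assume j(u, w) = λ·m(u, w) for all w, j(i·u, w) = λ·m(i·u, w) for all w, m(u, i·u) = 0, and the quasi-isolation condition (A4): j(w, w) > λ·m(w, w) for every w ≠ 0 with m(u, w) = 0 and m(i·u, w) = 0. Then for all z ∈ V and all a, b ∈ ℝ, if j(z, w) − λ·m(z, w) = m(a·u + b·(i·u), w) for every w ∈ V, then a·u + b·(i·u) = 0. Hence no Jordan chain exists at λ and the algebraic multiplicity of λ equals its geometric multiplicity 2. -/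
/-- Absence of Jordan chains at the ground-state eigenvalue
(second part of Lemma 5.1, abstract form): under the eigenrelations for `u` and
`i·u`, and the quasi-isolation condition (A4), if
`j(z, ·) − λ·m(z, ·) = m(a·u + b·(i·u), ·)` then `a·u + b·(i·u) = 0`; hence no
Jordan chain exists at `λ`. -/
theorem no_jordan_chain_of_quasi_isolated {V : Type*} [AddCommGroup V] [Module ℂ V]
    (j m : V →ₗ[ℝ] V →ₗ[ℝ] ℝ)
    (hm_symm : ∀ x y : V, m x y = m y x)
    (hm_pos : ∀ v : V, v ≠ 0 → 0 < m v v)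
    (u : V) (hu : u ≠ 0) (lam : ℝ)
    (heig : ∀ w : V, j u w = lam * m u w)
    (heig' : ∀ w : V, j (Complex.I • u) w = lam * m (Complex.I • u) w)
    (hortho : m u (Complex.I • u) = 0)
    (hA4 : ∀ w : V, w ≠ 0 → m u w = 0 → m (Complex.I • u) w = 0 →
      lam * m w w < j w w) :
    ∀ z : V, ∀ a b : ℝ,
      (∀ w : V, j z w - lam * m z w = m (a • u + b • (Complex.I • u)) w) →
      a • u + b • (Complex.I • u) = 0 := by
  intro z a b hz
  have hv : Complex.I • u ≠ 0 := smul_ne_zero Complex.I_ne_zero hu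
  generalize Complex.I • u = v at *
  have hvu : m v u = 0 := by rw [hm_symm, hortho]
  have huu : m u u ≠ 0 := (hm_pos u hu).ne'
  have hvv : m v v ≠ 0 := (hm_pos v hv).ne'
  obtain ⟨y, hy⟩ : ∃ y, y = z - (m u z / m u u) • u - (m v z / m v v) • v := ⟨_, rfl⟩
  have huy : m u y = 0 := by
    simp [hy, hortho, huu]
  have hvy : m v y = 0 := by
    simp [hy, hvu, hvv]
  have hjy : ∀ w, j y w - lam * m y w = m (a • u + b • v) w := by
    intro w
    rw [← hz w, hy]
    simp only [map_sub, map_smul, LinearMap.sub_apply, LinearMap.smul_apply, smul_eq_mul,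
      heig, heig']
    ring
  have hy0 : y = 0 := by
    by_contra hne
    have hlt := hA4 y hne huy hvy
    have heq := hjy y
    simp only [map_add, map_smul, LinearMap.add_apply, LinearMap.smul_apply, smul_eq_mul,
      huy, hvy] at heq
    linarith
  by_contra hne
  have hpos := hm_pos _ hne
  rw [← hjy, hy0] at hpos
  simp at hpos
end
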